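/- arXiv:2603.27847 — 9 statements merged into one kernel-verified Lean document; each statement's English description precedes it below -/
import Mathlib

section
/- Let n ≥ 1, p ≥ 1 and let ℓ_1, …, ℓ_n and m_1, …, m_p be nonzero linear forms in ℚ[u_1, …, u_d] such that for every h ∈ {1,…,n} and h' ∈ {1,…,p} the forms ℓ_h and m_{h'} are non-proportional. Then the polynomial f := ℓ_1 ⋯ ℓ_{n−1} · m_1 ⋯ m_{p−1} (with the empty product equal to 1) does not belong to the ideal (e₁, e₂) of ℚ[u_1, …, u_d] generated by e₁ := ℓ_1 ⋯ ℓ_n and e₂ := m_1 ⋯ m_p. -/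
/-- The linear form in `ℚ[u_1, …, u_d]` with coefficient vector `c : Fin d → ℚ`. -/
noncomputable def linForm {d : ℕ} (c : Fin d → ℚ) : MvPolynomial (Fin d) ℚ :=
  ∑ i, MvPolynomial.C (c i) * MvPolynomial.X i

lemma linForm_coeff {d : ℕ} (c : Fin d → ℚ) (i : Fin d) :
    (linForm c).coeff (Finsupp.single i 1) = c i := by
  classical
  simp [linForm, MvPolynomial.coeff_sum, MvPolynomial.coeff_C_mul, MvPolynomial.coeff_X',
    Finsupp.single_left_inj]

lemma linForm_irred {d : ℕ} (c : Fin d → ℚ) (hc : c ≠ 0) : Irreducible (linForm c) := by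
  obtain ⟨i, hi⟩ := Function.ne_iff.mp hc
  have hi' : c i ≠ 0 := hi
  apply MvPolynomial.irreducible_of_totalDegree_eq_one
  · apply le_antisymm
    · unfold linForm
      apply MvPolynomial.totalDegree_finsetSum_le
      intro j _
      refine (MvPolynomial.totalDegree_mul _ _).trans ?_
      simp
    · have := MvPolynomial.le_totalDegree (p := linForm c) (s := Finsupp.single i 1)
        (by rw [MvPolynomial.mem_support_iff, linForm_coeff]; exact hi')
      simpa using this
  · intro r hr
    have := hr (Finsupp.single i 1)
    rw [linForm_coeff] at this
    rw [isUnit_iff_ne_zero]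
    rintro rfl
    exact hi' (by simpa using this)

lemma linForm_relPrime {d : ℕ} (a b : Fin d → ℚ) (ha : a ≠ 0) (hb : b ≠ 0)
    (h : LinearIndependent ℚ ![a, b]) : IsRelPrime (linForm a) (linForm b) := by
  rw [(linForm_irred a ha).isRelPrime_iff_not_dvd]
  intro hdvd
  obtain ⟨u, hu⟩ := (linForm_irred a ha).associated_of_dvd (linForm_irred b hb) hdvd
  obtain ⟨r, hr, hur⟩ := MvPolynomial.isUnit_iff_eq_C_of_isReduced.mp u.isUnit
  rw [LinearIndependent.pair_iff] at h
  have := h r (-1) (by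
    ext i
    have := congrArg (MvPolynomial.coeff (Finsupp.single i 1)) hu
    rw [hur, mul_comm, MvPolynomial.coeff_C_mul, linForm_coeff, linForm_coeff] at this
    simp [this])
  simp at this

/-- Let `ℓ_0, …, ℓ_n` and `m_0, …, m_p` (so `n+1 ≥ 1` and `p+1 ≥ 1` forms) be nonzero
linear forms in `ℚ[u_1, …, u_d]`, pairwise non-proportional between the two families.
Then `f := ℓ_0 ⋯ ℓ_{n-1} · m_0 ⋯ m_{p-1}` (omitting the last form of each family; the
empty product being `1`) does not belong to the ideal generated by
`e₁ := ℓ_0 ⋯ ℓ_n` and `e₂ := m_0 ⋯ m_p`. -/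
theorem prod_erase_last_not_mem_span_pair
    {d n p : ℕ} (hd : 0 < d)
    (c : Fin (n + 1) → Fin d → ℚ) (m : Fin (p + 1) → Fin d → ℚ)
    (hc : ∀ h, c h ≠ 0) (hm : ∀ h', m h' ≠ 0)
    (hind : ∀ h h', LinearIndependent ℚ ![c h, m h']) :
    (∏ h : Fin n, linForm (c h.castSucc)) * (∏ h' : Fin p, linForm (m h'.castSucc)) ∉
      Ideal.span {∏ h, linForm (c h), ∏ h', linForm (m h')} := by
  intro hmem
  have hrp : ∀ h h', IsRelPrime (linForm (c h)) (linForm (m h')) := fun h h' =>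
    linForm_relPrime _ _ (hc h) (hm h') (hind h h')
  rw [Ideal.mem_span_pair] at hmem
  obtain ⟨a, b, hab⟩ := hmem
  rw [Fin.prod_univ_castSucc (n := n), Fin.prod_univ_castSucc (n := p)] at hab
  set L := ∏ h : Fin n, linForm (c h.castSucc) with hL
  set M := ∏ h' : Fin p, linForm (m h'.castSucc) with hM
  set l := linForm (c (Fin.last n)) with hl
  set k := linForm (m (Fin.last p)) with hk
  have hL0 : L ≠ 0 := Finset.prod_ne_zero_iff.mpr fun h _ => (linForm_irred _ (hc _)).ne_zero
  have hM0 : M ≠ 0 := Finset.prod_ne_zero_iff.mpr fun h _ => (linForm_irred _ (hm _)).ne_zero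
  have hLM : IsRelPrime L (M * k) := by
    apply IsRelPrime.prod_left
    intro i _
    apply IsRelPrime.mul_right _ (hrp _ _)
    apply IsRelPrime.prod_right
    intro j _
    exact hrp _ _
  have hMl : IsRelPrime M l := by
    apply IsRelPrime.prod_left
    intro i _
    exact (hrp _ _).symm
  obtain ⟨b', rfl⟩ : L ∣ b := by
    apply hLM.dvd_of_dvd_mul_right
    exact ⟨M - a * l, by linear_combination hab⟩
  have h1 : a * l + b' * (M * k) = M := by
    apply mul_left_cancel₀ hL0
    linear_combination hab
  obtain ⟨a', rfl⟩ : M ∣ a := by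
    apply hMl.dvd_of_dvd_mul_right
    exact ⟨1 - b' * k, by linear_combination h1⟩
  have h2 : a' * l + b' * k = 1 := by
    apply mul_left_cancel₀ hM0
    linear_combination h1
  have := congrArg (MvPolynomial.eval 0) h2
  simp [hl, hk, linForm] at this
end

section
/- Let φ be a flow on a compact metric space X and F a strict Lyapunov function for φ. Let W ⊆ X be compact with Inv(W) ⊆ interior(W), set K := fix(φ) ∩ W, and let a ≤ b be real numbers with a ∉ F(K) and b ∉ F(K). Then Z := W ∩ F⁻¹([a, b]) satisfies Inv(Z) ⊆ interior(Z), and its exit set is exactly Z₋ = (F⁻¹({a}) ∩ W) ∪ (F⁻¹([a, b]) ∩ W₋). -/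
/-- The rest-point set of a flow. -/
def fixedSet {X : Type*} [TopologicalSpace X] (φ : Flow ℝ X) : Set X :=
  {x | ∀ t : ℝ, φ t x = x}

/-- The maximal invariant subset `Inv(W)` of a set `W`. -/
def invSet {X : Type*} [TopologicalSpace X] (φ : Flow ℝ X) (W : Set X) : Set X :=
  {x ∈ W | ∀ t : ℝ, φ t x ∈ W}

/-- The exit set `W₋` of `W`. -/
def exitSet {X : Type*} [TopologicalSpace X] (φ : Flow ℝ X) (W : Set X) : Set X :=
  {x ∈ W | ∀ t > (0 : ℝ), ∃ s, 0 ≤ s ∧ s < t ∧ φ s x ∉ W}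

theorem fixed_of_period {X : Type*} [TopologicalSpace X]
    (φ : Flow ℝ X) (F : X → ℝ)
    (hLyap : ∀ (x : X) (t : ℝ), 0 ≤ t → F (φ t x) ≤ F x)
    (hStrict : ∀ (x : X) (t : ℝ), 0 ≤ t → (F (φ t x) = F x ↔ φ t x = x))
    (x : X) (t : ℝ) (ht : 0 < t) (h : φ t x = x) : x ∈ fixedSet φ := by
  have hn : ∀ n : ℕ, φ (n * t) x = x := by
    intro n
    induction n with
    | zero => simp
    | succ k ih =>
      have : ((k + 1 : ℕ) : ℝ) * t = k * t + t := by push_cast; ring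
      rw [this, φ.map_add, h, ih]
  have hp : ∀ s : ℝ, 0 ≤ s → φ s x = x := by
    intro s hs
    obtain ⟨n, hn'⟩ := exists_nat_ge (s / t)
    have h1 : s ≤ n * t := (div_le_iff₀ ht).1 hn'
    have h2 := hLyap (φ s x) (n * t - s) (by linarith)
    rw [← φ.map_add, sub_add_cancel, hn n] at h2
    exact (hStrict x s hs).1 (le_antisymm (hLyap x s hs) h2)
  intro s
  rcases le_total 0 s with hs | hs
  · exact hp s hs
  · have h1 := hp (-s) (by linarith)
    have h2 : φ s (φ (-s) x) = x := by
      rw [← φ.map_add]; simp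
    rwa [h1] at h2

/-- Splitting of an isolating neighborhood: for compact `W` with
`Inv(W) ⊆ interior(W)`, `K := fix(φ) ∩ W`, and `a ≤ b` with `a, b ∉ F(K)`,
the set `Z := W ∩ F⁻¹([a,b])` satisfies `Inv(Z) ⊆ interior(Z)` and its exit set is
`Z₋ = (F⁻¹({a}) ∩ W) ∪ (F⁻¹([a,b]) ∩ W₋)`. -/
theorem split_isolating_block
    {X : Type*} [MetricSpace X] [CompactSpace X]
    (φ : Flow ℝ X) (F : X → ℝ) (hF : Continuous F)
    (hLyap : ∀ (x : X) (t : ℝ), 0 ≤ t → F (φ t x) ≤ F x)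
    (hStrict : ∀ (x : X) (t : ℝ), 0 ≤ t → (F (φ t x) = F x ↔ φ t x = x))
    (W : Set X) (hWc : IsCompact W)
    (hWiso : invSet φ W ⊆ interior W)
    (a b : ℝ) (hab : a ≤ b)
    (ha : a ∉ F '' (fixedSet φ ∩ W)) (hb : b ∉ F '' (fixedSet φ ∩ W)) :
    invSet φ (W ∩ F ⁻¹' Set.Icc a b) ⊆ interior (W ∩ F ⁻¹' Set.Icc a b) ∧
      exitSet φ (W ∩ F ⁻¹' Set.Icc a b) =
        (F ⁻¹' {a} ∩ W) ∪ (F ⁻¹' Set.Icc a b ∩ exitSet φ W) := by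
  have hfix : ∀ (x : X) (t : ℝ), 0 < t → F x ≤ F (φ t x) → x ∈ fixedSet φ := by
    intro x t ht h
    exact fixed_of_period φ F hLyap hStrict x t ht
      ((hStrict x t ht.le).1 (le_antisymm (hLyap x t ht.le) h))
  constructor
  · rintro x ⟨⟨hxW, hxa, hxb⟩, hx⟩
    have hxi : x ∈ interior W := hWiso ⟨hxW, fun t => (hx t).1⟩
    have h1 : a < F x := by
      refine lt_of_le_of_ne hxa fun he => ha ⟨x, ⟨hfix x 1 one_pos ?_, hxW⟩, he.symm⟩
      rw [← he]; exact (hx 1).2.1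
    have h2 : F x < b := by
      refine lt_of_le_of_ne hxb fun he => hb ⟨x, ⟨?_, hxW⟩, he⟩
      have hx1 : φ 1 (φ (-1) x) = x := by rw [← φ.map_add]; simp
      have hy : φ (-1) x ∈ fixedSet φ := by
        refine hfix _ 1 one_pos ?_
        rw [hx1, he]; exact (hx (-1)).2.2
      have hxy : φ (-1) x = x := (hy 1).symm.trans hx1
      rwa [hxy] at hy
    refine mem_interior.2 ⟨interior W ∩ F ⁻¹' Set.Ioo a b, ?_,
      isOpen_interior.inter (isOpen_Ioo.preimage hF), hxi, h1, h2⟩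
    exact Set.inter_subset_inter interior_subset (Set.preimage_mono Set.Ioo_subset_Icc_self)
  · ext x
    constructor
    · rintro ⟨⟨hxW, hxa, hxb⟩, hx⟩
      rcases hxa.eq_or_lt with he | hlt
      · exact Or.inl ⟨he.symm, hxW⟩
      · refine Or.inr ⟨⟨hxa, hxb⟩, hxW, fun t ht => ?_⟩
        have hc : Continuous fun s : ℝ => F (φ s x) :=
          hF.comp (φ.continuous continuous_id continuous_const)
        have hev : ∀ᶠ s in nhds (0 : ℝ), a < F (φ s x) :=
          hc.continuousAt.eventually (lt_mem_nhds (by simpa using hlt))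
        obtain ⟨δ, hδ, hd⟩ := Metric.eventually_nhds_iff.1 hev
        obtain ⟨s, hs0, hs, hsn⟩ := hx (min t δ) (lt_min ht hδ)
        refine ⟨s, hs0, hs.trans_le (min_le_left _ _), fun hsW => hsn ⟨hsW, ?_, ?_⟩⟩
        · refine (hd ?_).le
          rw [Real.dist_eq, sub_zero, abs_of_nonneg hs0]
          exact hs.trans_le (min_le_right _ _)
        · exact (hLyap x s hs0).trans hxb
    · rintro (⟨he, hxW⟩ | ⟨hxI, hxW, hx⟩)
      · have he' : F x = a := he
        refine ⟨⟨hxW, he'.ge, he'.le.trans hab⟩, fun t ht => ⟨t / 2, by linarith, by linarith, ?_⟩⟩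
        rintro ⟨-, h1, -⟩
        exact ha ⟨x, ⟨hfix x (t / 2) (by linarith) (he'.le.trans h1), hxW⟩, he'⟩
      · refine ⟨⟨hxW, hxI⟩, fun t ht => ?_⟩
        obtain ⟨s, h0, h1, h2⟩ := hx t ht
        exact ⟨s, h0, h1, fun h => h2 h.1⟩
end

section
/- Let φ be a flow on a compact metric space X and F a strict Lyapunov function for φ. Let W ⊆ X be compact, K := fix(φ) ∩ W, and let a ≤ b < c and ε > 0 be such that [b, c) ∩ F(K) = ∅ and closure(W₋) ⊆ {x ∈ W : F(x) < a − ε}. Set A := (W ∩ {x : F(x) ≤ b}) ∪ {x ∈ X : F(x) < a − ε} and B := (W ∩ {x : F(x) < c}) ∪ {x ∈ X : F(x) < a − ε}, so that A ⊆ B. Then the inclusion A ↪ B is a homotopy equivalence: there exist a continuous map ψ : B → A and homotopies from ψ composed with the inclusion to the identity of A, and from the inclusion composed with ψ to the identity of B. -/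
lemma aux_fixed {X : Type*} [MetricSpace X] (φ : Flow ℝ X) (F : X → ℝ)
    (hLyap : ∀ (x : X) (t : ℝ), 0 ≤ t → F (φ t x) ≤ F x)
    (hStrict : ∀ (x : X) (t : ℝ), 0 ≤ t → (F (φ t x) = F x ↔ φ t x = x))
    (x : X) (δ : ℝ) (hδ : 0 < δ) (h : φ δ x = x) : x ∈ fixedSet φ := by
  have hn : ∀ n : ℕ, φ (n * δ) x = x := by
    intro n
    induction n with
    | zero => simp
    | succ k ih =>
      have : ((k + 1 : ℕ) : ℝ) * δ = k * δ + δ := by push_cast; ring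
      rw [this, φ.map_add, h, ih]
  have hpos : ∀ t : ℝ, 0 ≤ t → φ t x = x := by
    intro t ht
    obtain ⟨n, hn'⟩ := exists_nat_ge (t / δ)
    have h1 : t ≤ n * δ := by rwa [div_le_iff₀ hδ] at hn'
    refine (hStrict x t ht).1 (le_antisymm (hLyap x t ht) ?_)
    have h2 := hLyap (φ t x) (n * δ - t) (by linarith)
    rw [← φ.map_add, sub_add_cancel, hn] at h2
    exact h2
  intro t
  rcases le_total 0 t with ht | ht
  · exact hpos t ht
  · have h1 := hpos (-t) (by linarith)
    calc φ t x = φ t (φ (-t) x) := by rw [h1]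
      _ = x := by rw [← φ.map_add]; simp

lemma aux_stay {X : Type*} [MetricSpace X] (φ : Flow ℝ X) (F : X → ℝ)
    (hLyap : ∀ (x : X) (t : ℝ), 0 ≤ t → F (φ t x) ≤ F x)
    (W : Set X) (hWc : IsClosed W) (d : ℝ)
    (hexit : ∀ x ∈ exitSet φ W, F x < d)
    (x : X) (hx : x ∈ W) (t : ℝ) (ht : 0 ≤ t) (hd : d ≤ F (φ t x)) : φ t x ∈ W := by
  have hc : Continuous fun r : ℝ => φ r x := φ.continuous continuous_id continuous_const
  have key : Set.Icc 0 t ⊆ {r : ℝ | φ r x ∈ W} := by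
    apply IsClosed.Icc_subset_of_forall_exists_gt
    · exact (hWc.preimage hc).inter isClosed_Icc
    · simpa using hx
    · rintro r ⟨hr, hr0, hrt⟩ y hy
      have h1 : d ≤ F (φ r x) := by
        have h2 := hLyap (φ r x) (t - r) (by linarith)
        rw [← φ.map_add, sub_add_cancel] at h2
        linarith
      have h3 : φ r x ∉ exitSet φ W := fun h => by linarith [hexit _ h]
      have h4 : ∃ u > (0 : ℝ), ∀ s, 0 ≤ s → s < u → φ s (φ r x) ∈ W := by
        by_contra! hcon
        exact h3 ⟨hr, fun u hu => hcon u hu⟩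
      obtain ⟨u, hu, h4⟩ := h4
      have hy' : r < y := hy
      have hm : 0 < min (u / 2) (y - r) := lt_min (by linarith) (by linarith)
      refine ⟨min (u / 2) (y - r) + r, ?_, by linarith, ?_⟩
      · have := h4 (min (u / 2) (y - r)) hm.le
          (lt_of_le_of_lt (min_le_left _ _) (by linarith))
        rw [← φ.map_add] at this
        exact this
      · linarith [min_le_right (u / 2) (y - r)]
  exact key ⟨ht, le_rfl⟩

lemma aux_hit {X : Type*} [MetricSpace X] (φ : Flow ℝ X) (F : X → ℝ) (hF : Continuous F)
    (hLyap : ∀ (x : X) (t : ℝ), 0 ≤ t → F (φ t x) ≤ F x)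
    (hStrict : ∀ (x : X) (t : ℝ), 0 ≤ t → (F (φ t x) = F x ↔ φ t x = x))
    (W : Set X) (hWc : IsCompact W) (b : ℝ) (x : X)
    (hW : ∀ t : ℝ, 0 ≤ t → φ t x ∈ W) (hb : ∀ t : ℝ, 0 ≤ t → b < F (φ t x)) :
    ∃ y ∈ fixedSet φ ∩ W, b ≤ F y ∧ F y ≤ F x := by
  obtain ⟨y, hy, k, hk, hlim⟩ := hWc.tendsto_subseq (x := fun n : ℕ => φ (n : ℝ) x)
    (fun n => hW n (Nat.cast_nonneg n))
  have hmono : ∀ s t : ℝ, s ≤ t → F (φ t x) ≤ F (φ s x) := by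
    intro s t h
    have h2 := hLyap (φ s x) (t - s) (by linarith)
    rwa [← φ.map_add, sub_add_cancel] at h2
  have hFy : Filter.Tendsto (fun n => F (φ (k n : ℝ) x)) Filter.atTop (nhds (F y)) :=
    (hF.tendsto y).comp hlim
  -- every value along the forward trajectory is at least F y
  have hge : ∀ t : ℝ, F y ≤ F (φ t x) := by
    intro t
    refine le_of_tendsto hFy ?_
    obtain ⟨N, hN⟩ := exists_nat_ge t
    filter_upwards [Filter.eventually_ge_atTop N] with n hn
    apply hmono
    have : N ≤ k n := hn.trans (hk.id_le n)
    have : (N : ℝ) ≤ k n := by exact_mod_cast this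
    linarith
  have h1 : φ 1 y = y := by
    refine (hStrict y 1 zero_le_one).1 (le_antisymm (hLyap y 1 zero_le_one) ?_)
    have hc : Continuous fun z => F (φ 1 z) := hF.comp (φ.continuous continuous_const continuous_id)
    refine ge_of_tendsto' ((hc.tendsto y).comp hlim) fun n => ?_
    simp only [Function.comp]
    rw [← φ.map_add]
    exact hge _
  refine ⟨y, ⟨aux_fixed φ F hLyap hStrict y 1 one_pos h1, hy⟩, ?_, ?_⟩
  · exact ge_of_tendsto' hFy fun n => (hb _ (Nat.cast_nonneg _)).le
  · simpa using hge 0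

/-- Deformation lemma: with `K := fix(φ) ∩ W`, `a ≤ b < c`, `ε > 0`,
`[b, c) ∩ F(K) = ∅` and `closure(W₋) ⊆ {x ∈ W : F x < a - ε}`, the inclusion
`(W ∩ {F ≤ b}) ∪ {F < a - ε} ↪ (W ∩ {F < c}) ∪ {F < a - ε}` is a homotopy
equivalence. -/
theorem deformation_homotopy_equivalence
    {X : Type*} [MetricSpace X] [CompactSpace X]
    (φ : Flow ℝ X) (F : X → ℝ) (hF : Continuous F)
    (hLyap : ∀ (x : X) (t : ℝ), 0 ≤ t → F (φ t x) ≤ F x)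
    (hStrict : ∀ (x : X) (t : ℝ), 0 ≤ t → (F (φ t x) = F x ↔ φ t x = x))
    (W : Set X) (hWc : IsCompact W)
    (a b c ε : ℝ) (hab : a ≤ b) (hbc : b < c) (hε : 0 < ε)
    (hreg : Set.Ico b c ∩ F '' (fixedSet φ ∩ W) = ∅)
    (hexit : closure (exitSet φ W) ⊆ {x ∈ W | F x < a - ε})
    (hsub : (W ∩ {x | F x ≤ b}) ∪ {x | F x < a - ε} ⊆
      (W ∩ {x | F x < c}) ∪ {x | F x < a - ε}) :
    ∃ ψ : C(((W ∩ {x | F x < c}) ∪ {x | F x < a - ε} : Set X),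
            ((W ∩ {x | F x ≤ b}) ∪ {x | F x < a - ε} : Set X)),
      (ψ.comp (⟨Set.inclusion hsub, continuous_inclusion hsub⟩ :
          C(((W ∩ {x | F x ≤ b}) ∪ {x | F x < a - ε} : Set X),
            ((W ∩ {x | F x < c}) ∪ {x | F x < a - ε} : Set X)))).Homotopic
        (ContinuousMap.id _) ∧
      ((⟨Set.inclusion hsub, continuous_inclusion hsub⟩ :
          C(((W ∩ {x | F x ≤ b}) ∪ {x | F x < a - ε} : Set X),
            ((W ∩ {x | F x < c}) ∪ {x | F x < a - ε} : Set X))).comp ψ).Homotopic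
        (ContinuousMap.id _) := by
  classical
  have hex : ∀ x ∈ exitSet φ W, F x < a - ε := fun x hx => (hexit (subset_closure hx)).2
  have hstay := aux_stay φ F hLyap W hWc.isClosed (a - ε) hex
  have hreg' : ∀ y ∈ fixedSet φ ∩ W, b ≤ F y → F y < c → False := by
    intro y hy h1 h2
    have : F y ∈ Set.Ico b c ∩ F '' (fixedSet φ ∩ W) := ⟨⟨h1, h2⟩, y, hy, rfl⟩
    rw [hreg] at this
    exact this
  have hmono : ∀ (x : X) (s t : ℝ), s ≤ t → F (φ t x) ≤ F (φ s x) := by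
    intro x s t h
    have h2 := hLyap (φ s x) (t - s) (by linarith)
    rwa [← φ.map_add, sub_add_cancel] at h2
  have hcx : ∀ x, Continuous fun r : ℝ => F (φ r x) := fun x =>
    hF.comp (φ.continuous continuous_id continuous_const)
  have hct : ∀ t : ℝ, Continuous fun x => F (φ t x) := fun t =>
    hF.comp (φ.continuous continuous_const continuous_id)
  set A : Set X := (W ∩ {x | F x ≤ b}) ∪ {x | F x < a - ε} with hA
  set B : Set X := (W ∩ {x | F x < c}) ∪ {x | F x < a - ε} with hB
  have hAb : ∀ x ∈ A, F x ≤ b := by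
    rintro x (⟨_, h⟩ | h)
    · exact h
    · have : F x < a - ε := h
      linarith
  have hBc : ∀ x ∈ B, F x < c := by
    rintro x (⟨_, h⟩ | h)
    · exact h
    · have : F x < a - ε := h
      linarith
  have hBW : ∀ x ∈ B, a - ε ≤ F x → x ∈ W := by
    rintro x (⟨h, _⟩ | h) h2
    · exact h
    · have : F x < a - ε := h
      linarith
  have hBt : ∀ x ∈ B, ∀ t : ℝ, 0 ≤ t → φ t x ∈ B := by
    intro x hx t ht
    by_cases h : F (φ t x) < a - ε
    · exact Or.inr h
    · push Not at h
      have h0 := hLyap x t ht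
      exact Or.inl ⟨hstay x (hBW x hx (by linarith)) t ht h, lt_of_le_of_lt h0 (hBc x hx)⟩
  have hBA : ∀ x ∈ B, F x ≤ b → x ∈ A := by
    rintro x (⟨h, _⟩ | h) h2
    · exact Or.inl ⟨h, h2⟩
    · exact Or.inr h
  have hhit : ∀ x ∈ B, ∃ t : ℝ, 0 ≤ t ∧ F (φ t x) ≤ b := by
    intro x hx
    by_contra! hcon
    obtain ⟨y, hy, h1, h2⟩ := aux_hit φ F hF hLyap hStrict W hWc b x
      (fun t ht => hBW _ (hBt x hx t ht) (by linarith [hcon t ht])) hcon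
    exact hreg' y hy h1 (lt_of_le_of_lt h2 (hBc x hx))
  have hT : ∀ x : B, ∃ T : ℝ, 0 ≤ T ∧ F (φ T x) ≤ b ∧ ∀ t : ℝ, 0 ≤ t → F (φ t x) ≤ b → T ≤ t := by
    intro x
    have hcl : IsClosed {t : ℝ | 0 ≤ t ∧ F (φ t x) ≤ b} :=
      isClosed_Ici.inter (isClosed_Iic.preimage (hcx x))
    have hbd : BddBelow {t : ℝ | 0 ≤ t ∧ F (φ t x) ≤ b} := ⟨0, fun t ht => ht.1⟩
    have hmem := hcl.csInf_mem (hhit x x.2) hbd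
    exact ⟨_, hmem.1, hmem.2, fun t h1 h2 => csInf_le hbd ⟨h1, h2⟩⟩
  choose T hT0 hTb hTmin using hT
  have hlt : ∀ x : B, ∀ δ > 0, F (φ (T x + δ) x) < b := by
    intro x δ hδ
    have hy := hBt x x.2 (T x) (hT0 x)
    have h1 := hLyap (φ (T x) x) δ hδ.le
    rw [add_comm, φ.map_add]
    rcases lt_or_eq_of_le (hTb x) with h | h
    · linarith
    · refine lt_of_le_of_ne (by linarith) fun h2 => ?_
      have h3 := (hStrict (φ (T x) x) δ hδ.le).1 (by rw [h2, h])
      exact hreg' _ ⟨aux_fixed φ F hLyap hStrict _ δ hδ h3, hBW _ hy (by linarith)⟩ h.ge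
        (by linarith)
  have hTc : Continuous T := by
    rw [continuous_iff_continuousAt]
    intro x
    refine tendsto_order.2 ⟨fun s hs => ?_, fun s hs => ?_⟩
    · by_cases h0 : s < 0
      · exact Filter.Eventually.of_forall fun y => lt_of_lt_of_le h0 (hT0 y)
      · push Not at h0
        have h1 : b < F (φ s x) := by
          by_contra! h
          linarith [hTmin x s h0 h]
        have h2 := ((hct s).comp continuous_subtype_val).tendsto x |>.eventually_const_lt h1
        filter_upwards [h2] with y hy
        by_contra! h
        have hy' : b < F (φ s y) := hy
        linarith [hmono y _ _ h, hTb y]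
    · have h1 := hlt x ((s - T x) / 2) (by linarith)
      have h2 := ((hct (T x + (s - T x) / 2)).comp continuous_subtype_val).tendsto x
        |>.eventually_lt_const h1
      filter_upwards [h2] with y hy
      have hy' : F (φ (T x + (s - T x) / 2) y) < b := hy
      have := hTmin y _ (by linarith [hT0 x]) hy'.le
      linarith
  have hTA : ∀ x : B, F x ≤ b → T x = 0 := fun x hx =>
    le_antisymm (hTmin x 0 le_rfl (by simpa using hx)) (hT0 x)
  let ψ : C(B, A) := ⟨fun x => ⟨φ (T x) x, hBA _ (hBt x x.2 _ (hT0 x)) (hTb x)⟩,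
    (φ.continuous hTc continuous_subtype_val).subtype_mk _⟩
  refine ⟨ψ, ?_, ?_⟩
  · have : ψ.comp ⟨Set.inclusion hsub, continuous_inclusion hsub⟩ = ContinuousMap.id _ := by
      ext x
      have h : T (Set.inclusion hsub x) = 0 := hTA _ (hAb x x.2)
      simp [ψ, h]
    rw [this]
  · symm
    refine ⟨{ toFun := fun p => ⟨φ ((p.1 : ℝ) * T p.2) p.2,
                hBt _ p.2.2 _ (mul_nonneg p.1.2.1 (hT0 _))⟩
              continuous_toFun := ?_
              map_zero_left := ?_
              map_one_left := ?_ }⟩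
    · refine (φ.continuous ?_ ?_).subtype_mk _
      · exact (continuous_subtype_val.comp continuous_fst).mul (hTc.comp continuous_snd)
      · exact continuous_subtype_val.comp continuous_snd
    · intro x
      ext
      simp
    · intro x
      ext
      simp [ψ]
end

section
/- Let φ be a flow on a compact metric space X and F a strict Lyapunov function for φ. Let W ⊆ X be compact and suppose F(W) contains at most one critical value, i.e. the set F(W) ∩ F(fix(φ)) is a subsingleton. Then Inv(W) = fix(φ) ∩ W. -/
/-- If `F(W)` contains at most one critical value of a strict Lyapunov function `F`
for the flow `φ` on a compact metric space, then `Inv(W) = fix(φ) ∩ W`. -/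
theorem invSet_eq_fixedSet_inter
    {X : Type*} [MetricSpace X] [CompactSpace X]
    (φ : Flow ℝ X) (F : X → ℝ) (hF : Continuous F)
    (hLyap : ∀ (x : X) (t : ℝ), 0 ≤ t → F (φ t x) ≤ F x)
    (hStrict : ∀ (x : X) (t : ℝ), 0 ≤ t → (F (φ t x) = F x ↔ φ t x = x))
    (W : Set X) (hWc : IsCompact W)
    (hone : (F '' W ∩ F '' fixedSet φ).Subsingleton) :
    invSet φ W = fixedSet φ ∩ W := by
  have hadd : ∀ (s t : ℝ) (x : X), φ (s + t) x = φ s (φ t x) := fun s t x => φ.map_add s t x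
  have hz : ∀ x : X, φ 0 x = x := fun x => φ.map_zero_apply x
  have hpos : ∀ x : X, (∀ t : ℝ, 0 ≤ t → φ t x = x) → x ∈ fixedSet φ := by
    intro x h t
    rcases le_total 0 t with ht | ht
    · exact h t ht
    · have h1 := h (-t) (by linarith)
      have h2 := hadd t (-t) x
      rw [h1, add_neg_cancel, hz] at h2
      exact h2.symm
  have hneg : ∀ x : X, (∀ t : ℝ, 0 ≤ t → φ (-t) x = x) → x ∈ fixedSet φ := by
    intro x h
    refine hpos x fun t ht => ?_
    have h1 := h t ht
    have h2 := hadd t (-t) x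
    rw [h1, add_neg_cancel, hz] at h2
    exact h2.symm
  have hinv : ∀ x ∈ invSet φ W, ∀ t : ℝ, φ t x ∈ invSet φ W := by
    intro x hx t
    refine ⟨hx.2 t, fun s => ?_⟩
    rw [← hadd]
    exact hx.2 _
  have hclosed : IsClosed (invSet φ W) := by
    have : invSet φ W = W ∩ ⋂ t : ℝ, (fun x => φ t x) ⁻¹' W := by
      ext x
      simp [invSet]
    rw [this]
    exact hWc.isClosed.inter (isClosed_iInter fun t =>
      hWc.isClosed.preimage (φ.continuous_toFun t))
  apply Set.Subset.antisymm
  · intro x hx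
    refine ⟨?_, hx.1⟩
    obtain ⟨m, hm, hmin⟩ := hclosed.isCompact.exists_isMinOn ⟨x, hx⟩ hF.continuousOn
    obtain ⟨M, hM, hmax⟩ := hclosed.isCompact.exists_isMaxOn ⟨x, hx⟩ hF.continuousOn
    have hmf : m ∈ fixedSet φ := hpos m fun t ht =>
      (hStrict m t ht).1 (le_antisymm (hLyap m t ht) (hmin (hinv m hm t)))
    have hMf : M ∈ fixedSet φ := by
      refine hneg M fun t ht => ?_
      have h2 : φ t (φ (-t) M) = M := by rw [← hadd, add_neg_cancel, hz]
      have h3 := hLyap (φ (-t) M) t ht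
      have h4 : F (φ (-t) M) ≤ F M := hmax (hinv M hM (-t))
      have h5 := (hStrict (φ (-t) M) t ht).1 (le_antisymm h3 (by rw [h2]; exact h4))
      rw [h2] at h5
      exact h5.symm
    have heq : F m = F M := hone ⟨⟨m, hm.1, rfl⟩, ⟨m, hmf, rfl⟩⟩ ⟨⟨M, hM.1, rfl⟩, ⟨M, hMf, rfl⟩⟩
    refine hpos x fun t ht => (hStrict x t ht).1 (le_antisymm (hLyap x t ht) ?_)
    have h6 : F m ≤ F (φ t x) := hmin (hinv x hx t)
    have h7 : F x ≤ F M := hmax hx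
    linarith
  · rintro x ⟨hx, hW⟩
    exact ⟨hW, fun t => by rw [hx t]; exact hW⟩
end

section
/- For all real numbers g > 0, κ > 0, h > 0 and s > 0, the set {t ∈ ℝ : t > 0 and ω̆(t) = s·t} has at most two elements; that is, for any speed s the radial gravity–capillary dispersion relation has at most two positive resonant wavenumbers. -/
open Real in
lemma aux_pos {f f' : ℝ → ℝ} (h0 : f 0 = 0) (hf : ∀ x, HasDerivAt f (f' x) x)
    (hp : ∀ x, 0 < x → 0 < f' x) : ∀ x, 0 < x → 0 < f x := by
  intro x hx
  have hm : StrictMonoOn f (Set.Ici 0) := by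
    apply strictMonoOn_of_deriv_pos (convex_Ici 0)
    · exact fun y _ => (hf y).continuousAt.continuousWithinAt
    · intro y hy
      rw [interior_Ici] at hy
      rw [(hf y).deriv]
      exact hp y hy
  have := hm (Set.mem_Ici.2 le_rfl) (Set.mem_Ici.2 hx.le) hx
  rwa [h0] at this

lemma aux_cosh (x : ℝ) (hx : 0 < x) : 0 < Real.cosh x - (1 + x ^ 2 / 2) := by
  refine aux_pos (f := fun x => Real.cosh x - (1 + x ^ 2 / 2)) (f' := fun x => Real.sinh x - x)
    (by simp) (fun x => ?_) (fun x hx => ?_) x hx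
  · refine HasDerivAt.congr_deriv ((Real.hasDerivAt_cosh x).sub (((hasDerivAt_id' x).pow 2).div_const 2 |>.const_add 1)) ?_
    simp
  · have := Real.self_lt_sinh_iff.2 hx
    simpa using this

lemma aux_sinh (x : ℝ) (hx : 0 < x) : 0 < Real.sinh x - (x + x ^ 3 / 6) := by
  refine aux_pos (f := fun x => Real.sinh x - (x + x ^ 3 / 6))
    (f' := fun x => Real.cosh x - (1 + x ^ 2 / 2)) (by simp) (fun x => ?_) aux_cosh x hx
  refine HasDerivAt.congr_deriv ((Real.hasDerivAt_sinh x).sub ((hasDerivAt_id' x).add (((hasDerivAt_id' x).pow 3).div_const 6))) ?_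
  simp; ring

lemma aux_xch (x : ℝ) (hx : 0 < x) : 0 < x * Real.cosh x - Real.sinh x := by
  refine aux_pos (f := fun x => x * Real.cosh x - Real.sinh x)
    (f' := fun x => x * Real.sinh x) (by simp) (fun x => ?_)
    (fun x hx => mul_pos hx (Real.sinh_pos_iff.2 hx)) x hx
  refine HasDerivAt.congr_deriv (((hasDerivAt_id' x).mul (Real.hasDerivAt_cosh x)).sub (Real.hasDerivAt_sinh x)) ?_
  simp

lemma aux_th (x : ℝ) (hx : 0 < x) : 0 < Real.sinh x - (x - x ^ 3 / 3) * Real.cosh x := by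
  refine aux_pos (f := fun x => Real.sinh x - (x - x ^ 3 / 3) * Real.cosh x)
    (f' := fun x => x * (x * Real.cosh x - Real.sinh x) + x ^ 3 / 3 * Real.sinh x)
    (by simp) (fun x => ?_) (fun x hx => ?_) x hx
  · refine HasDerivAt.congr_deriv ((Real.hasDerivAt_sinh x).sub (((hasDerivAt_id' x).sub
      (((hasDerivAt_id' x).pow 3).div_const 3)).mul (Real.hasDerivAt_cosh x))) ?_
    simp; ring
  · have := aux_xch x hx
    have := Real.sinh_pos_iff.2 hx
    positivity

lemma aux_key (x : ℝ) (hx : 0 < x) :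
    2 * x ^ 2 * Real.cosh x < x * Real.sinh x + Real.sinh x ^ 2 * Real.cosh x := by
  have h1 := aux_th x hx
  have h2 := aux_sinh x hx
  have hc := Real.cosh_pos x
  have h3 : x ^ 2 + x ^ 4 / 3 ≤ Real.sinh x ^ 2 := by
    have : (x + x ^ 3 / 6) ^ 2 ≤ Real.sinh x ^ 2 :=
      pow_le_pow_left₀ (by positivity) (by linarith) 2
    nlinarith [sq_nonneg (x ^ 3)]
  have h4 := mul_le_mul_of_nonneg_right h3 hc.le
  have h5 := mul_pos hx h1
  nlinarith

lemma aux_anti : StrictAntiOn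
    (fun x : ℝ => (Real.sinh x * Real.cosh x - x) / (x * Real.sinh x ^ 2)) (Set.Ioi 0) := by
  have hd : ∀ x : ℝ, 0 < x → HasDerivAt
      (fun x : ℝ => (Real.sinh x * Real.cosh x - x) / (x * Real.sinh x ^ 2))
      (((Real.cosh x * Real.cosh x + Real.sinh x * Real.sinh x - 1) * (x * Real.sinh x ^ 2) -
        (Real.sinh x * Real.cosh x - x) * (Real.sinh x ^ 2 + x * (2 * Real.sinh x * Real.cosh x)))
        / (x * Real.sinh x ^ 2) ^ 2) x := by
    intro x hx
    have hs := Real.sinh_pos_iff.2 hx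
    refine HasDerivAt.congr_deriv ((((Real.hasDerivAt_sinh x).mul (Real.hasDerivAt_cosh x)).sub (hasDerivAt_id' x)).div
      ((hasDerivAt_id' x).mul ((Real.hasDerivAt_sinh x).pow 2)) (by simp; positivity)) ?_
    simp
  apply strictAntiOn_of_deriv_neg (convex_Ioi 0)
  · exact fun y hy => (hd y hy).continuousAt.continuousWithinAt
  · intro x hx
    rw [interior_Ioi] at hx
    have hx : 0 < x := hx
    rw [(hd x hx).deriv]
    have hs := Real.sinh_pos_iff.2 hx
    apply div_neg_of_neg_of_pos _ (by positivity)
    have hk := mul_pos hs (sub_pos.2 (aux_key x hx))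
    have hsq := Real.cosh_sq x
    have : (Real.cosh x * Real.cosh x + Real.sinh x * Real.sinh x - 1) * (x * Real.sinh x ^ 2) -
        (Real.sinh x * Real.cosh x - x) * (Real.sinh x ^ 2 + x * (2 * Real.sinh x * Real.cosh x))
        = - (Real.sinh x * (x * Real.sinh x + Real.sinh x ^ 2 * Real.cosh x
          - 2 * x ^ 2 * Real.cosh x)) := by
      linear_combination (-x * Real.sinh x ^ 2) * hsq
    linarith

lemma aux_rolle (A B a b : ℝ) (ha : 0 < a) (hab : a < b)
    (h1 : a * Real.cosh a / Real.sinh a = A + B * a ^ 2)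
    (h2 : b * Real.cosh b / Real.sinh b = A + B * b ^ 2) :
    ∃ x ∈ Set.Ioo a b,
      (Real.sinh x * Real.cosh x - x) / (x * Real.sinh x ^ 2) = 2 * B := by
  have hd : ∀ x : ℝ, 0 < x → HasDerivAt
      (fun x : ℝ => x * Real.cosh x / Real.sinh x - (A + B * x ^ 2))
      ((Real.sinh x * Real.cosh x - x) / Real.sinh x ^ 2 - 2 * B * x) x := by
    intro x hx
    have hs := Real.sinh_pos_iff.2 hx
    refine HasDerivAt.congr_deriv ((((hasDerivAt_id' x).mul (Real.hasDerivAt_cosh x)).div (Real.hasDerivAt_sinh x)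
      hs.ne').sub ((((hasDerivAt_id' x).pow 2).const_mul B).const_add A)) ?_
    simp
    field_simp
    linear_combination (-x) * Real.cosh_sq x
  obtain ⟨x, hx, hx'⟩ := exists_hasDerivAt_eq_zero hab
    (fun y hy => (hd y (ha.trans_le hy.1)).continuousAt.continuousWithinAt)
    (by simp [h1, h2]) (fun y hy => hd y (ha.trans hy.1))
  refine ⟨x, hx, ?_⟩
  have hx0 : 0 < x := ha.trans hx.1
  have hs := Real.sinh_pos_iff.2 hx0
  field_simp at hx' ⊢
  linarith

lemma aux_three (A B a b c : ℝ) (ha : 0 < a) (hab : a < b) (hbc : b < c)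
    (h1 : a * Real.cosh a / Real.sinh a = A + B * a ^ 2)
    (h2 : b * Real.cosh b / Real.sinh b = A + B * b ^ 2)
    (h3 : c * Real.cosh c / Real.sinh c = A + B * c ^ 2) : False := by
  obtain ⟨x, hx, hx'⟩ := aux_rolle A B a b ha hab h1 h2
  obtain ⟨y, hy, hy'⟩ := aux_rolle A B b c (ha.trans hab) hbc h2 h3
  have := aux_anti (Set.mem_Ioi.2 (ha.trans hx.1)) (Set.mem_Ioi.2 ((ha.trans hab).trans hy.1))
    (hx.2.trans hy.1)
  simp only [hx', hy'] at this
  exact lt_irrefl _ this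

lemma aux_set (S : Set ℝ) (hS : ∀ a ∈ S, ∀ b ∈ S, ∀ c ∈ S, a < b → b < c → False) :
    ∃ x y : ℝ, S ⊆ {x, y} := by
  by_cases h : ∃ x ∈ S, ∃ y ∈ S, x < y
  · obtain ⟨x, hx, y, hy, hxy⟩ := h
    refine ⟨x, y, fun z hz => ?_⟩
    by_contra hn
    simp only [Set.mem_insert_iff, Set.mem_singleton_iff, not_or] at hn
    rcases lt_or_gt_of_ne hn.1 with h1 | h1
    · exact hS z hz x hx y hy h1 hxy
    · rcases lt_or_gt_of_ne hn.2 with h2 | h2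
      · exact hS x hx z hz y hy h1 h2
      · exact hS x hx y hy z hz hxy h2
  · push Not at h
    by_cases h' : ∃ x, x ∈ S
    · obtain ⟨x, hx⟩ := h'
      exact ⟨x, x, fun z hz => Or.inl (le_antisymm (h x hx z hz) (h z hz x hx))⟩
    · exact ⟨0, 0, fun z hz => (h' ⟨z, hz⟩).elim⟩

/-- For any gravity `g > 0`, surface tension `κ > 0`, depth `h > 0` and speed `s > 0`,
the radial gravity–capillary dispersion relation
`ω̆(t) = √((g + κ t²) t tanh(h t))` has at most two positive solutions of
`ω̆(t) = s·t`. -/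
theorem dispersion_at_most_two_resonant_wavenumbers
    (g κ h s : ℝ) (hg : 0 < g) (hκ : 0 < κ) (hh : 0 < h) (hs : 0 < s) :
    ∃ x y : ℝ,
      {t : ℝ | 0 < t ∧ Real.sqrt ((g + κ * t ^ 2) * t * Real.tanh (h * t)) = s * t} ⊆
        {x, y} := by
  apply aux_set
  have key : ∀ t ∈ {t : ℝ | 0 < t ∧
      Real.sqrt ((g + κ * t ^ 2) * t * Real.tanh (h * t)) = s * t}, 0 < h * t ∧
      (h * t) * Real.cosh (h * t) / Real.sinh (h * t) =
        h * g / s ^ 2 + κ / (h * s ^ 2) * (h * t) ^ 2 := by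
    rintro t ⟨ht, he⟩
    have hx : 0 < h * t := mul_pos hh ht
    refine ⟨hx, ?_⟩
    have hsh := Real.sinh_pos_iff.2 hx
    have hc := Real.cosh_pos (h * t)
    rw [Real.tanh_eq_sinh_div_cosh] at he
    have h2 : (g + κ * t ^ 2) * t * (Real.sinh (h * t) / Real.cosh (h * t)) = (s * t) ^ 2 := by
      rw [← he, Real.sq_sqrt]
      positivity
    generalize Real.sinh (h * t) = S at *
    generalize Real.cosh (h * t) = C at *
    field_simp at h2 ⊢
    linarith
  intro a ha b hb c hc hab hbc
  exact aux_three _ _ _ _ _ (key a ha).1 (mul_lt_mul_of_pos_left hab hh)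
    (mul_lt_mul_of_pos_left hbc hh) (key a ha).2 (key b hb).2 (key c hc).2
end

section
/- Let g, κ, h > 0, let A be an invertible 2×2 real matrix with dual lattice Γ' := {A⁻ᵀ k : k ∈ ℤ²}, and let c ∈ ℝ². Then the set {j ∈ Γ' : j ≠ 0 and ω(j) ≤ ‖c‖·‖j‖} is finite; in particular, the set of resonant wave vectors {j ∈ Γ' : j ≠ 0 and ω(j) = c·j} is finite. -/
/-- Euclidean norm on `ℝ²`. -/
noncomputable def enorm2 (x : Fin 2 → ℝ) : ℝ := Real.sqrt (x 0 ^ 2 + x 1 ^ 2)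

/-- Euclidean inner product on `ℝ²`. -/
def edot (x y : Fin 2 → ℝ) : ℝ := x 0 * y 0 + x 1 * y 1

/-- The gravity–capillary dispersion relation `ω(ξ) = √((g + κ‖ξ‖²)‖ξ‖ tanh(h‖ξ‖))`. -/
noncomputable def disp (g κ h : ℝ) (ξ : Fin 2 → ℝ) : ℝ :=
  Real.sqrt ((g + κ * enorm2 ξ ^ 2) * enorm2 ξ * Real.tanh (h * enorm2 ξ))

/-- The dual lattice `Γ' = {A⁻ᵀ k : k ∈ ℤ²}` of an invertible matrix `A`. -/
noncomputable def dualLattice (A : Matrix (Fin 2) (Fin 2) ℝ) : Set (Fin 2 → ℝ) :=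
  {j | ∃ k : Fin 2 → ℤ, j = (A.transpose)⁻¹.mulVec fun i => (k i : ℝ)}


lemma enorm2_nonneg (x : Fin 2 → ℝ) : 0 ≤ enorm2 x := Real.sqrt_nonneg _

lemma enorm2_sq (x : Fin 2 → ℝ) : enorm2 x ^ 2 = x 0 ^ 2 + x 1 ^ 2 :=
  Real.sq_sqrt (by positivity)

lemma my_tanh_mono {a b : ℝ} (h : a ≤ b) : Real.tanh a ≤ Real.tanh b := by
  rw [Real.tanh_eq_sinh_div_cosh, Real.tanh_eq_sinh_div_cosh,
    div_le_div_iff₀ (Real.cosh_pos _) (Real.cosh_pos _)]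
  have : 0 ≤ Real.sinh (b - a) := Real.sinh_nonneg_iff.2 (by linarith)
  rw [Real.sinh_sub] at this
  linarith

lemma my_tanh_pos {a : ℝ} (h : 0 < a) : 0 < Real.tanh a := by
  rw [Real.tanh_eq_sinh_div_cosh]
  exact div_pos (Real.sinh_pos_iff.2 h) (Real.cosh_pos _)

lemma enorm2_bound (g κ h : ℝ) (hg : 0 < g) (hκ : 0 < κ) (hh : 0 < h) (C : ℝ)
    (j : Fin 2 → ℝ) (hj : disp g κ h j ≤ C * enorm2 j) :
    enorm2 j ≤ max 1 (C ^ 2 / (κ * Real.tanh h)) := by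
  by_contra! hlt
  obtain ⟨h1, h2⟩ := max_lt_iff.1 hlt
  have ht := my_tanh_pos hh
  unfold disp at hj
  generalize enorm2 j = r at *
  have hm : Real.tanh h ≤ Real.tanh (h * r) := my_tanh_mono (by nlinarith)
  have hr : 0 < r := by linarith
  have hp : 0 < Real.tanh (h * r) := by linarith
  have h3 : (g + κ * r ^ 2) * r * Real.tanh (h * r) ≤ (C * r) ^ 2 := by
    rw [← Real.sq_sqrt (show 0 ≤ (g + κ * r ^ 2) * r * Real.tanh (h * r) by positivity)]
    exact pow_le_pow_left₀ (Real.sqrt_nonneg _) hj 2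
  have h4 : κ * r ^ 2 * r * Real.tanh h ≤ (g + κ * r ^ 2) * r * Real.tanh (h * r) := by
    gcongr
    linarith
  rw [div_lt_iff₀ (by positivity)] at h2
  have : r ^ 2 * C ^ 2 < r ^ 2 * (r * (κ * Real.tanh h)) := by gcongr
  nlinarith

lemma lattice_finite (A : Matrix (Fin 2) (Fin 2) ℝ) (hA : IsUnit A.det) (R : ℝ) :
    {j : Fin 2 → ℝ | j ∈ dualLattice A ∧ enorm2 j ≤ R}.Finite := by
  have hb : ∀ j : Fin 2 → ℝ, enorm2 j ≤ R → ∀ i, |j i| ≤ R := by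
    intro j hj i
    refine le_trans ?_ hj
    refine abs_le_of_sq_le_sq ?_ (enorm2_nonneg j)
    rw [enorm2_sq]
    fin_cases i <;> simp <;> positivity
  let N : ℤ := ⌈∑ i, ∑ l, |A l i| * R⌉
  refine ((Set.finite_Icc (fun _ : Fin 2 => -N) (fun _ => N)).image
    (fun k : Fin 2 → ℤ => (A.transpose)⁻¹.mulVec fun i => (k i : ℝ))).subset ?_
  rintro j ⟨⟨k, hk⟩, hj⟩
  refine ⟨k, ?_, hk.symm⟩
  have hR : 0 ≤ R := (enorm2_nonneg j).trans hj
  have hk' : (fun i => (k i : ℝ)) = A.transpose.mulVec j := by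
    rw [hk, Matrix.mulVec_mulVec, Matrix.mul_nonsing_inv _ (by simpa using hA),
      Matrix.one_mulVec]
  have key : ∀ i, |k i| ≤ N := by
    intro i
    have : (|(k i : ℝ)|) ≤ N := by
      refine le_trans ?_ (Int.le_ceil _)
      have e : (k i : ℝ) = ∑ l, A l i * j l := by
        have := congrFun hk' i
        simpa [Matrix.mulVec, dotProduct] using this
      rw [e]
      calc |∑ l, A l i * j l| ≤ ∑ l, |A l i * j l| := Finset.abs_sum_le_sum_abs _ _
        _ ≤ ∑ l, |A l i| * R := by
          refine Finset.sum_le_sum fun l _ => ?_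
          rw [abs_mul]
          exact mul_le_mul_of_nonneg_left (hb j hj l) (abs_nonneg _)
        _ ≤ _ := Finset.single_le_sum (f := fun i => ∑ l, |A l i| * R)
          (fun i _ => by positivity) (Finset.mem_univ i)
    exact_mod_cast this
  exact ⟨fun i => (abs_le.1 (key i)).1, fun i => (abs_le.1 (key i)).2⟩

lemma edot_le (c j : Fin 2 → ℝ) : edot c j ≤ enorm2 c * enorm2 j := by
  refine (le_abs_self _).trans (abs_le_of_sq_le_sq ?_ (mul_nonneg (enorm2_nonneg c) (enorm2_nonneg j)))
  rw [mul_pow, enorm2_sq, enorm2_sq, edot]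
  nlinarith [sq_nonneg (c 0 * j 1 - c 1 * j 0)]

/-- For `g, κ, h > 0`, an invertible `2×2` matrix `A` and any `c ∈ ℝ²`, the set of
nonzero dual-lattice vectors `j` with `ω(j) ≤ ‖c‖·‖j‖` is finite; in particular the
set of resonant wave vectors `{j ∈ Γ' : j ≠ 0, ω(j) = c·j}` is finite. -/
theorem resonant_wave_vectors_finite
    (g κ h : ℝ) (hg : 0 < g) (hκ : 0 < κ) (hh : 0 < h)
    (A : Matrix (Fin 2) (Fin 2) ℝ) (hA : IsUnit A.det) (c : Fin 2 → ℝ) :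
    {j : Fin 2 → ℝ | j ∈ dualLattice A ∧ j ≠ 0 ∧
        disp g κ h j ≤ enorm2 c * enorm2 j}.Finite ∧
      {j : Fin 2 → ℝ | j ∈ dualLattice A ∧ j ≠ 0 ∧
        disp g κ h j = edot c j}.Finite := by
  have h1 : {j : Fin 2 → ℝ | j ∈ dualLattice A ∧ j ≠ 0 ∧
        disp g κ h j ≤ enorm2 c * enorm2 j}.Finite :=
    (lattice_finite A hA _).subset fun j hj =>
      ⟨hj.1, enorm2_bound g κ h hg hκ hh (enorm2 c) j hj.2.2⟩
  exact ⟨h1, h1.subset fun j hj => ⟨hj.1, hj.2.1, hj.2.2.le.trans (edot_le c j)⟩⟩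
end

section
/- Let ι be a finite index set, u : ι → ℝ² a family of vectors with u_k = (u_{k,1}, u_{k,2}), and w : ι → ℝ a family of nonnegative weights. Then det(Σ_{k∈ι} w_k · u_k u_kᵀ) > 0 if and only if there exist k, l ∈ ι with w_k > 0, w_l > 0 and u_{k,1}·u_{l,2} − u_{k,2}·u_{l,1} ≠ 0 (i.e. u_k and u_l are linearly independent). -/
theorem two_det_aux {ι : Type*} [Fintype ι] (u : ι → Fin 2 → ℝ) (w : ι → ℝ) :
    2 * (∑ k, w k • Matrix.vecMulVec (u k) (u k)).det =
      ∑ k, ∑ l, w k * w l * (u k 0 * u l 1 - u k 1 * u l 0) ^ 2 := by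
  have h : ∀ k l, w k * w l * (u k 0 * u l 1 - u k 1 * u l 0) ^ 2 =
      (w k * (u k 0 * u k 0)) * (w l * (u l 1 * u l 1))
      + (w k * (u k 1 * u k 1)) * (w l * (u l 0 * u l 0))
      - 2 * ((w k * (u k 0 * u k 1)) * (w l * (u l 0 * u l 1))) := by
    intro k l; ring
  have h10 : ∑ k, w k * (u k 1 * u k 0) = ∑ k, w k * (u k 0 * u k 1) :=
    Finset.sum_congr rfl fun k _ => by ring
  simp only [h, Finset.sum_add_distrib, Finset.sum_sub_distrib, ← Finset.mul_sum,
    ← Finset.sum_mul]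
  simp only [Matrix.det_fin_two, Matrix.sum_apply, Matrix.smul_apply, Matrix.vecMulVec_apply,
    smul_eq_mul, h10]
  ring

/-- For a finite family of vectors `u_k ∈ ℝ²` and nonnegative weights `w_k`, the
determinant of `Σ_k w_k u_k u_kᵀ` is positive iff some pair `u_k, u_l` with positive
weights is linearly independent. -/
theorem det_sum_weighted_vecMulVec_pos_iff
    {ι : Type*} [Fintype ι] (u : ι → Fin 2 → ℝ) (w : ι → ℝ) (hw : ∀ k, 0 ≤ w k) :
    0 < (∑ k, w k • Matrix.vecMulVec (u k) (u k)).det ↔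
      ∃ k l, 0 < w k ∧ 0 < w l ∧ u k 0 * u l 1 - u k 1 * u l 0 ≠ 0 := by
  have key := two_det_aux u w
  have hn : ∀ k l, 0 ≤ w k * w l * (u k 0 * u l 1 - u k 1 * u l 0) ^ 2 := fun k l =>
    mul_nonneg (mul_nonneg (hw k) (hw l)) (sq_nonneg _)
  constructor
  · intro hpos
    by_contra hne
    have hz : ∑ k, ∑ l, w k * w l * (u k 0 * u l 1 - u k 1 * u l 0) ^ 2 = 0 := by
      refine Finset.sum_eq_zero fun k _ => Finset.sum_eq_zero fun l _ => ?_
      by_contra h0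
      apply hne
      refine ⟨k, l, lt_of_le_of_ne (hw k) ?_, lt_of_le_of_ne (hw l) ?_, ?_⟩
      · intro h; apply h0; rw [← h]; ring
      · intro h; apply h0; rw [← h]; ring
      · intro h; apply h0; rw [h]; ring
    linarith
  · rintro ⟨k, l, hk, hl, h⟩
    have hp : 0 < ∑ k, ∑ l, w k * w l * (u k 0 * u l 1 - u k 1 * u l 0) ^ 2 := by
      refine Finset.sum_pos' (fun k _ => Finset.sum_nonneg fun l _ => hn k l)
        ⟨k, Finset.mem_univ _, ?_⟩
      refine Finset.sum_pos' (fun l _ => hn k l) ⟨l, Finset.mem_univ _, ?_⟩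
      positivity
    linarith
end

section
/- Let u_k ∈ ℝ² (k ∈ ι) be unit vectors and let a ∈ ℝ² with a ≠ 0. Assume u_k·a^⊥ ≥ 0 for every k ∈ ι, and that u_k = −a/‖a‖ whenever u_k·a^⊥ = 0; set ι₀ := {k ∈ ι : u_k·a^⊥ = 0}. Then the level set {v ∈ V : ℐ(v) = a} equals {v ∈ V : v_k = 0 for all k ∉ ι₀, and Σ_{k∈ι₀} ‖v_k‖² = 2‖a‖}; in particular it is a sphere of radius √(2‖a‖) in the subspace Π_{k∈ι₀} H_k. -/
open scoped Classical

/-- Rotation by 90 degrees: `a^⊥ := (−a_2, a_1)`. -/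
def perp (a : Fin 2 → ℝ) : Fin 2 → ℝ := ![-(a 1), a 0]

/-- If the unit vectors `u_k` satisfy `u_k · a^⊥ ≥ 0`, with `u_k = −a/‖a‖` whenever
`u_k · a^⊥ = 0`, then the level set `{ℐ = a}` of the momentum map
`ℐ(v) = −(1/2) Σ_k ‖v_k‖² u_k` is the sphere
`{v : v_k = 0 for k ∉ ι₀, Σ_{k ∈ ι₀} ‖v_k‖² = 2‖a‖}`, where
`ι₀ = {k : u_k · a^⊥ = 0}`. -/
theorem levelSet_momentum_collinear
    {ι : Type*} [Fintype ι] (H : ι → Type*)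
    [∀ k, NormedAddCommGroup (H k)] [∀ k, InnerProductSpace ℝ (H k)]
    (u : ι → Fin 2 → ℝ) (hu : ∀ k, enorm2 (u k) = 1)
    (a : Fin 2 → ℝ) (ha : a ≠ 0)
    (hpos : ∀ k, 0 ≤ edot (u k) (perp a))
    (hcol : ∀ k, edot (u k) (perp a) = 0 → u k = -((enorm2 a)⁻¹ • a)) :
    {v : ∀ k, H k | (-(1 / 2) : ℝ) • ∑ k, ‖v k‖ ^ 2 • u k = a} =
      {v : ∀ k, H k | (∀ k, edot (u k) (perp a) ≠ 0 → v k = 0) ∧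
        ∑ k ∈ Finset.univ.filter (fun k => edot (u k) (perp a) = 0), ‖v k‖ ^ 2 =
          2 * enorm2 a} := by
  have hN : 0 < enorm2 a := by
    unfold enorm2
    apply Real.sqrt_pos.2
    by_contra hle
    apply ha
    have h0 : a 0 = 0 := by nlinarith [sq_nonneg (a 0), sq_nonneg (a 1)]
    have h1 : a 1 = 0 := by nlinarith [sq_nonneg (a 0), sq_nonneg (a 1)]
    ext i
    fin_cases i
    · exact h0
    · exact h1
  have key : ∀ v : (∀ k, H k), (∀ k, edot (u k) (perp a) ≠ 0 → v k = 0) →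
      (-(1 / 2) : ℝ) • ∑ k, ‖v k‖ ^ 2 • u k =
      ((∑ k ∈ Finset.univ.filter (fun k => edot (u k) (perp a) = 0), ‖v k‖ ^ 2) /
        (2 * enorm2 a)) • a := by
    intro v hv
    have h1 : ∑ k, ‖v k‖ ^ 2 • u k =
        ∑ k ∈ Finset.univ.filter (fun k => edot (u k) (perp a) = 0),
          ‖v k‖ ^ 2 • (-((enorm2 a)⁻¹ • a)) := by
      rw [Finset.sum_filter]
      refine Finset.sum_congr rfl fun k _ => ?_
      split_ifs with h
      · rw [hcol k h]
      · simp [hv k h]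
    rw [h1, ← Finset.sum_smul, ← neg_smul, smul_smul, smul_smul]
    congr 1
    field_simp
  ext v
  simp only [Set.mem_setOf_eq]
  constructor
  · intro h
    have hc : ∀ i, ∑ k, ‖v k‖ ^ 2 * u k i = -2 * a i := by
      intro i
      have := congrFun h i
      simp only [Pi.smul_apply, Finset.sum_apply, smul_eq_mul] at this
      linarith
    have hs : ∑ k, ‖v k‖ ^ 2 * edot (u k) (perp a) = 0 := by
      have : ∀ k, ‖v k‖ ^ 2 * edot (u k) (perp a) =
          (‖v k‖ ^ 2 * u k 0) * (-(a 1)) + (‖v k‖ ^ 2 * u k 1) * a 0 := by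
        intro k
        simp [edot, perp]
        ring
      simp only [this]
      rw [Finset.sum_add_distrib, ← Finset.sum_mul, ← Finset.sum_mul, hc, hc]
      ring
    have hv : ∀ k, edot (u k) (perp a) ≠ 0 → v k = 0 := by
      intro k hk
      have := (Finset.sum_eq_zero_iff_of_nonneg
        (fun k _ => mul_nonneg (sq_nonneg ‖v k‖) (hpos k))).1 hs k (Finset.mem_univ k)
      simpa [hk] using this
    refine ⟨hv, ?_⟩
    rw [key v hv] at h
    have h2 := smul_left_injective ℝ ha (h.trans (one_smul ℝ a).symm)
    rwa [div_eq_one_iff_eq (by positivity)] at h2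
  · rintro ⟨hv, hS⟩
    rw [key v hv, hS, div_self (by positivity), one_smul]
end

section
/- Let u_k ∈ ℝ² (k ∈ ι) be unit vectors and let a ∈ ℝ² with a ≠ 0 be such that u_k·a^⊥ ≠ 0 for every k ∈ ι, and suppose there exists c ∈ ℝ² with u_k·c > 0 for all k ∈ ι and a·c < 0. Set ι₋ := {k ∈ ι : u_k·a^⊥ < 0} and ι₊ := {k ∈ ι : u_k·a^⊥ > 0}. Then the level set {v ∈ V : ℐ(v) = a}, with the subspace topology, is homeomorphic to the product S₋ × S₊, where S₋ is the unit sphere {v ∈ Π_{k∈ι₋} H_k : Σ_{k∈ι₋} ‖v_k‖² = 1} and S₊ is the unit sphere {v ∈ Π_{k∈ι₊} H_k : Σ_{k∈ι₊} ‖v_k‖² = 1}. -/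
open scoped Classical

theorem aux_sum_sub {ι : Type*} [Fintype ι] (P : ι → Prop) [Fintype {k // P k}] [DecidablePred P]
    (f : ι → ℝ) : ∑ k : {k // P k}, f k.1 = ∑ k, if P k then f k else 0 := by
  rw [← Finset.sum_filter]
  exact (Finset.sum_subtype _ (by simp) f).symm

theorem aux_neg {ι : Type*} [Fintype ι] (p x : ι → ℝ) (h0 : ∑ k, x k * p k = 0) :
    ∑ k : {k // p k < 0}, |p k.1| * x k.1 = (∑ k, |p k| * x k) / 2 := by
  rw [aux_sum_sub (fun k => p k < 0) (fun k => |p k| * x k)]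
  have : ∀ k, (if p k < 0 then |p k| * x k else 0) = (|p k| * x k) / 2 - (x k * p k) / 2 := by
    intro k
    split_ifs with h
    · rw [abs_of_neg h]; ring
    · rw [abs_of_nonneg (not_lt.1 h)]; ring
  simp only [this, Finset.sum_sub_distrib, ← Finset.sum_div, h0]
  ring

theorem aux_pos_s18 {ι : Type*} [Fintype ι] (p x : ι → ℝ) (h0 : ∑ k, x k * p k = 0) :
    ∑ k : {k // 0 < p k}, |p k.1| * x k.1 = (∑ k, |p k| * x k) / 2 := by
  rw [aux_sum_sub (fun k => 0 < p k) (fun k => |p k| * x k)]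
  have : ∀ k, (if 0 < p k then |p k| * x k else 0) = (|p k| * x k) / 2 + (x k * p k) / 2 := by
    intro k
    split_ifs with h
    · rw [abs_of_pos h]; ring
    · rw [abs_of_nonpos (not_lt.1 h)]; ring
  simp only [this, Finset.sum_add_distrib, ← Finset.sum_div, h0]
  ring

section glue
set_option linter.unusedSectionVars false
variable {ι : Type*} [Fintype ι] {H : ι → Type*}
    [∀ k, NormedAddCommGroup (H k)] [∀ k, InnerProductSpace ℝ (H k)]

/-- Glue two partial vectors. -/
noncomputable def aux_glue (p : ι → ℝ) 
    (w₁ : ∀ k : {k : ι // p k < 0}, H k.1) (w₂ : ∀ k : {k : ι // 0 < p k}, H k.1) : ∀ k, H k :=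
  fun k => if h : p k < 0 then w₁ ⟨k, h⟩ else if h' : 0 < p k then w₂ ⟨k, h'⟩ else 0

theorem aux_glue_neg (p : ι → ℝ) 
    (w₁ : ∀ k : {k : ι // p k < 0}, H k.1) (w₂ : ∀ k : {k : ι // 0 < p k}, H k.1)
    (k : {k : ι // p k < 0}) : aux_glue p w₁ w₂ k.1 = w₁ k := by
  simp [aux_glue, k.2]

theorem aux_glue_pos (p : ι → ℝ) 
    (w₁ : ∀ k : {k : ι // p k < 0}, H k.1) (w₂ : ∀ k : {k : ι // 0 < p k}, H k.1)
    (k : {k : ι // 0 < p k}) : aux_glue p w₁ w₂ k.1 = w₂ k := by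
  simp [aux_glue, k.2, not_lt.2 k.2.le]

theorem aux_glue_ext (p : ι → ℝ) (hp : ∀ k, p k ≠ 0)
    (w₁ : ∀ k : {k : ι // p k < 0}, H k.1) (w₂ : ∀ k : {k : ι // 0 < p k}, H k.1)
    (v : ∀ k, H k) (h1 : ∀ k, w₁ k = v k.1) (h2 : ∀ k, w₂ k = v k.1) :
    aux_glue p w₁ w₂ = v := by
  funext k
  rcases lt_or_gt_of_ne (hp k) with h | h
  · rw [aux_glue_neg p w₁ w₂ ⟨k, h⟩, h1]
  · rw [aux_glue_pos p w₁ w₂ ⟨k, h⟩, h2]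

theorem aux_glue_cont (p : ι → ℝ) :
    Continuous (fun w : (∀ k : {k : ι // p k < 0}, H k.1) × (∀ k : {k : ι // 0 < p k}, H k.1) =>
      aux_glue p w.1 w.2) := by
  refine continuous_pi fun k => ?_
  unfold aux_glue
  split_ifs with h h'
  · exact (continuous_apply (⟨k, h⟩ : {k : ι // p k < 0})).comp continuous_fst
  · exact (continuous_apply (⟨k, h'⟩ : {k : ι // 0 < p k})).comp continuous_snd
  · exact continuous_const

/-- total absolute moment -/
noncomputable def aux_R (p : ι → ℝ) (v : ∀ k, H k) : ℝ := ∑ k, |p k| * ‖v k‖ ^ 2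

/-- total weight -/
noncomputable def aux_Q (p q : ι → ℝ) (v : ∀ k, H k) : ℝ := ∑ k, q k / |p k| * ‖v k‖ ^ 2

theorem aux_R_cont (p : ι → ℝ) : Continuous (aux_R (H := H) p) := by
  unfold aux_R; fun_prop

theorem aux_Q_cont (p q : ι → ℝ) : Continuous (aux_Q (H := H) p q) := by
  unfold aux_Q; fun_prop

theorem aux_sum_pos (f : ι → ℝ) (hf : ∀ k, 0 < f k) (v : ∀ k, H k) (hv : v ≠ 0) :
    0 < ∑ k, f k * ‖v k‖ ^ 2 := by
  obtain ⟨k, hk⟩ := Function.ne_iff.1 hv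
  refine Finset.sum_pos' (fun i _ => by have := hf i; positivity) ⟨k, Finset.mem_univ _, ?_⟩
  have := hf k
  have : 0 < ‖v k‖ := norm_pos_iff.2 hk
  have := hf k
  positivity

theorem aux_normsq (v : ∀ k, H k) (t b : ℝ) (ht : 0 ≤ t) (hb : 0 ≤ b) (k : ι) :
    ‖(√t * √b) • v k‖ ^ 2 = t * (b * ‖v k‖ ^ 2) := by
  rw [norm_smul, mul_pow, Real.norm_eq_abs, sq_abs, mul_pow, Real.sq_sqrt ht, Real.sq_sqrt hb]
  ring

theorem aux_main (p q : ι → ℝ) (s : ℝ) (hp : ∀ k, p k ≠ 0) (hq : ∀ k, 0 < q k) (hs : 0 < s)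
    (L : (∀ k, H k) → Prop)
    (hL : ∀ v, L v ↔ (∑ k, ‖v k‖ ^ 2 * p k = 0 ∧ ∑ k, q k * ‖v k‖ ^ 2 = s)) :
    Nonempty ({v : ∀ k, H k // L v} ≃ₜ
      ({w : ∀ k : {k : ι // p k < 0}, H k.1 // ∑ k, ‖w k‖ ^ 2 = 1} ×
       {w : ∀ k : {k : ι // 0 < p k}, H k.1 // ∑ k, ‖w k‖ ^ 2 = 1})) := by
  have hap : ∀ k, 0 < |p k| := fun k => abs_pos.2 (hp k)
  have hR : ∀ v : {v : ∀ k, H k // L v}, 0 < aux_R p v.1 := by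
    intro v
    refine aux_sum_pos _ hap _ ?_
    intro h0
    have := ((hL _).1 v.2).2
    simp [h0] at this
    exact hs.ne this
  have hQ : ∀ w : ({w : ∀ k : {k : ι // p k < 0}, H k.1 // ∑ k, ‖w k‖ ^ 2 = 1} ×
       {w : ∀ k : {k : ι // 0 < p k}, H k.1 // ∑ k, ‖w k‖ ^ 2 = 1}),
       0 < aux_Q p q (aux_glue p w.1.1 w.2.1) := by
    intro w
    refine aux_sum_pos (fun k => q k / |p k|) (fun k => div_pos (hq k) (hap k)) _ ?_
    intro h0
    have h1 : ∀ k, w.1.1 k = 0 := fun k => by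
      rw [← aux_glue_neg p w.1.1 w.2.1 k, h0]; rfl
    have := w.1.2
    simp [h1] at this
  refine ⟨{
    toFun := fun v =>
      (⟨fun k => (√(2 / aux_R p v.1) * √|p k.1|) • v.1 k.1, ?_⟩,
       ⟨fun k => (√(2 / aux_R p v.1) * √|p k.1|) • v.1 k.1, ?_⟩)
    invFun := fun w =>
      ⟨fun k => (√(s / aux_Q p q (aux_glue p w.1.1 w.2.1)) * √(|p k|⁻¹)) •
        aux_glue p w.1.1 w.2.1 k, ?_⟩
    left_inv := ?_
    right_inv := ?_
    continuous_toFun := ?_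
    continuous_invFun := ?_ }⟩
  · have hr := hR v
    simp only [aux_normsq v.1 _ _ (div_pos two_pos hr).le (abs_nonneg _)]
    rw [← Finset.mul_sum, aux_neg p (fun k => ‖v.1 k‖ ^ 2) ((hL _).1 v.2).1]
    change 2 / aux_R p v.1 * (aux_R p v.1 / 2) = 1
    field_simp
  · have hr := hR v
    simp only [aux_normsq v.1 _ _ (div_pos two_pos hr).le (abs_nonneg _)]
    rw [← Finset.mul_sum, aux_pos_s18 p (fun k => ‖v.1 k‖ ^ 2) ((hL _).1 v.2).1]
    change 2 / aux_R p v.1 * (aux_R p v.1 / 2) = 1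
    field_simp
  · have hr := hQ w
    rw [hL]
    simp only [aux_normsq (aux_glue p w.1.1 w.2.1) _ _ (div_pos hs hr).le
      (inv_nonneg.2 (abs_nonneg _))]
    constructor
    · have h1 : ∑ k : {k // p k < 0}, ‖aux_glue p w.1.1 w.2.1 k.1‖ ^ 2 = 1 := by
        simp only [aux_glue_neg]; exact w.1.2
      have h2 : ∑ k : {k // 0 < p k}, ‖aux_glue p w.1.1 w.2.1 k.1‖ ^ 2 = 1 := by
        simp only [aux_glue_pos]; exact w.2.2
      generalize aux_glue p w.1.1 w.2.1 = g at *
      rw [aux_sum_sub (fun k => p k < 0) (fun k => ‖g k‖ ^ 2)] at h1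
      rw [aux_sum_sub (fun k => 0 < p k) (fun k => ‖g k‖ ^ 2)] at h2
      have : ∀ k, s / aux_Q p q g * (|p k|⁻¹ * ‖g k‖ ^ 2) * p k = s / aux_Q p q g *
          ((if 0 < p k then ‖g k‖ ^ 2 else 0) - (if p k < 0 then ‖g k‖ ^ 2 else 0)) := by
        intro k
        rcases lt_or_gt_of_ne (hp k) with h | h
        · rw [if_pos h, if_neg (not_lt.2 h.le), abs_of_neg h]
          have := h.ne
          field_simp
          ring
        · rw [if_pos h, if_neg (not_lt.2 h.le), abs_of_pos h]
          field_simp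
          ring
      rw [Finset.sum_congr rfl fun k _ => this k, ← Finset.mul_sum, Finset.sum_sub_distrib, h1, h2]
      simp
    · generalize aux_glue p w.1.1 w.2.1 = g at *
      have : ∀ k, q k * (s / aux_Q p q g * (|p k|⁻¹ * ‖g k‖ ^ 2)) =
          s / aux_Q p q g * (q k / |p k| * ‖g k‖ ^ 2) := fun k => by ring
      rw [Finset.sum_congr rfl fun k _ => this k, ← Finset.mul_sum]
      change s / aux_Q p q g * aux_Q p q g = s
      field_simp
  · intro v
    apply Subtype.ext
    have hr := hR v
    have hg : aux_glue p (fun k : {k // p k < 0} => (√(2 / aux_R p v.1) * √|p k.1|) • v.1 k.1)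
        (fun k : {k // 0 < p k} => (√(2 / aux_R p v.1) * √|p k.1|) • v.1 k.1) =
        fun k => (√(2 / aux_R p v.1) * √|p k|) • v.1 k :=
      aux_glue_ext p hp _ _ _ (fun _ => rfl) (fun _ => rfl)
    simp only [hg]
    have hq' : aux_Q p q (fun k => (√(2 / aux_R p v.1) * √|p k|) • v.1 k)
        = 2 / aux_R p v.1 * s := by
      unfold aux_Q
      simp only [aux_normsq v.1 _ _ (div_pos two_pos hr).le (abs_nonneg _)]
      rw [← ((hL _).1 v.2).2, Finset.mul_sum]
      refine Finset.sum_congr rfl fun k _ => ?_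
      have := (hap k).ne'
      field_simp
    rw [hq']
    funext k
    rw [smul_smul]
    have e : √(s / (2 / aux_R p v.1 * s)) * √(|p k|⁻¹) * (√(2 / aux_R p v.1) * √|p k|) = 1 := by
      rw [show s / (2 / aux_R p v.1 * s) = (2 / aux_R p v.1)⁻¹ by field_simp,
        Real.sqrt_inv, Real.sqrt_inv]
      have h1 := (Real.sqrt_pos.2 (div_pos two_pos hr)).ne'
      have h2 := (Real.sqrt_pos.2 (hap k)).ne'
      generalize √(2 / aux_R p v.1) = x at *
      generalize √|p k| = y at *
      field_simp
    rw [e, one_smul]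
  · intro w
    have hr := hQ w
    have hsum : ∑ k, ‖aux_glue p w.1.1 w.2.1 k‖ ^ 2 = 2 := by
      have h1 : ∑ k : {k // p k < 0}, ‖aux_glue p w.1.1 w.2.1 k.1‖ ^ 2 = 1 := by
        simp only [aux_glue_neg]; exact w.1.2
      have h2 : ∑ k : {k // 0 < p k}, ‖aux_glue p w.1.1 w.2.1 k.1‖ ^ 2 = 1 := by
        simp only [aux_glue_pos]; exact w.2.2
      generalize aux_glue p w.1.1 w.2.1 = g at *
      rw [aux_sum_sub (fun k => p k < 0) (fun k => ‖g k‖ ^ 2)] at h1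
      rw [aux_sum_sub (fun k => 0 < p k) (fun k => ‖g k‖ ^ 2)] at h2
      rw [show (2 : ℝ) = (∑ k, if p k < 0 then ‖g k‖ ^ 2 else 0) +
        (∑ k, if 0 < p k then ‖g k‖ ^ 2 else 0) by rw [h1, h2]; norm_num,
        ← Finset.sum_add_distrib]
      refine Finset.sum_congr rfl fun k _ => ?_
      rcases lt_or_gt_of_ne (hp k) with h | h <;> simp [h, not_lt.2 h.le]
    have hR' : aux_R p (fun k => (√(s / aux_Q p q (aux_glue p w.1.1 w.2.1)) * √(|p k|⁻¹)) •
        aux_glue p w.1.1 w.2.1 k) = s / aux_Q p q (aux_glue p w.1.1 w.2.1) * 2 := by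
      unfold aux_R
      simp only [aux_normsq (aux_glue p w.1.1 w.2.1) _ _ (div_pos hs hr).le
        (inv_nonneg.2 (abs_nonneg _))]
      rw [← hsum, Finset.mul_sum]
      refine Finset.sum_congr rfl fun k _ => ?_
      have := (hap k).ne'
      field_simp
    have e : ∀ k, √(2 / (s / aux_Q p q (aux_glue p w.1.1 w.2.1) * 2)) * √|p k| *
        (√(s / aux_Q p q (aux_glue p w.1.1 w.2.1)) * √(|p k|⁻¹)) = 1 := by
      intro k
      have h1 := (Real.sqrt_pos.2 (div_pos hs hr)).ne'
      have h2 := (Real.sqrt_pos.2 (hap k)).ne'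
      rw [show 2 / (s / aux_Q p q (aux_glue p w.1.1 w.2.1) * 2) =
        (s / aux_Q p q (aux_glue p w.1.1 w.2.1))⁻¹ by field_simp,
        Real.sqrt_inv, Real.sqrt_inv]
      generalize √(s / aux_Q p q (aux_glue p w.1.1 w.2.1)) = x at *
      generalize √|p k| = y at *
      field_simp
    refine Prod.ext (Subtype.ext ?_) (Subtype.ext ?_)
    · funext k
      simp only [hR']
      rw [smul_smul, e, one_smul, aux_glue_neg]
    · funext k
      simp only [hR']
      rw [smul_smul, e, one_smul, aux_glue_pos]
  · have hc : Continuous fun v : {v : ∀ k, H k // L v} => √(2 / aux_R p v.1) :=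
      Real.continuous_sqrt.comp (continuous_const.div
        ((aux_R_cont p).comp continuous_subtype_val) (fun v => (hR v).ne'))
    refine Continuous.prodMk (Continuous.subtype_mk (continuous_pi fun k => ?_) _)
      (Continuous.subtype_mk (continuous_pi fun k => ?_) _)
    · exact (hc.mul continuous_const).smul ((continuous_apply k.1).comp continuous_subtype_val)
    · exact (hc.mul continuous_const).smul ((continuous_apply k.1).comp continuous_subtype_val)
  · have hg : Continuous fun w : ({w : ∀ k : {k : ι // p k < 0}, H k.1 // ∑ k, ‖w k‖ ^ 2 = 1} ×
       {w : ∀ k : {k : ι // 0 < p k}, H k.1 // ∑ k, ‖w k‖ ^ 2 = 1}) =>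
        aux_glue p w.1.1 w.2.1 :=
      (aux_glue_cont p).comp ((continuous_subtype_val.comp continuous_fst).prodMk
        (continuous_subtype_val.comp continuous_snd))
    refine Continuous.subtype_mk (continuous_pi fun k => ?_) _
    refine Continuous.smul (Continuous.mul ?_ continuous_const) ((continuous_apply k).comp hg)
    exact Real.continuous_sqrt.comp (continuous_const.div
      ((aux_Q_cont p q).comp hg) (fun v => (hQ v).ne'))

end glue


/-- Non-collinear case: if the unit vectors `u_k` satisfy `u_k · a^⊥ ≠ 0` for all `k`,
and there is `c` with `u_k · c > 0` for all `k` and `a · c < 0`, then the level set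
`{v : ℐ(v) = a}` of the momentum map `ℐ(v) = −(1/2) Σ_k ‖v_k‖² u_k`, with the subspace
topology, is homeomorphic to the product of the unit spheres of `Π_{k ∈ ι₋} H_k` and
`Π_{k ∈ ι₊} H_k`, where `ι∓ = {k : ± u_k · a^⊥ > 0}`. -/
theorem levelSet_momentum_noncollinear_homeomorph
    {ι : Type*} [Fintype ι] (H : ι → Type*)
    [∀ k, NormedAddCommGroup (H k)] [∀ k, InnerProductSpace ℝ (H k)]
    (u : ι → Fin 2 → ℝ) (hu : ∀ k, enorm2 (u k) = 1)
    (a : Fin 2 → ℝ) (ha : a ≠ 0)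
    (hnc : ∀ k, edot (u k) (perp a) ≠ 0)
    (hcone : ∃ c : Fin 2 → ℝ, (∀ k, 0 < edot (u k) c) ∧ edot a c < 0) :
    Nonempty
      (({v : ∀ k, H k // (-(1 / 2) : ℝ) • ∑ k, ‖v k‖ ^ 2 • u k = a}) ≃ₜ
        ({w : ∀ k : {k : ι // edot (u k) (perp a) < 0}, H k.1 //
            ∑ k, ‖w k‖ ^ 2 = 1} ×
         {w : ∀ k : {k : ι // 0 < edot (u k) (perp a)}, H k.1 //
            ∑ k, ‖w k‖ ^ 2 = 1})) := by
  obtain ⟨c, hc, hac⟩ := hcone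
  refine aux_main (fun k => edot (u k) (perp a)) (fun k => edot (u k) c) (-2 * edot a c) hnc hc
    (by linarith) _ ?_
  intro v
  have e1 : ∀ d : Fin 2 → ℝ, ∑ k, ‖v k‖ ^ 2 * edot (u k) d =
      (∑ k, ‖v k‖ ^ 2 * u k 0) * d 0 + (∑ k, ‖v k‖ ^ 2 * u k 1) * d 1 := by
    intro d
    rw [Finset.sum_mul, Finset.sum_mul, ← Finset.sum_add_distrib]
    refine Finset.sum_congr rfl fun k _ => ?_
    unfold edot
    ring
  have e2 : ∑ k, edot (u k) c * ‖v k‖ ^ 2 = ∑ k, ‖v k‖ ^ 2 * edot (u k) c :=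
    Finset.sum_congr rfl fun k _ => mul_comm _ _
  rw [e2, e1, e1, funext_iff, Fin.forall_fin_two]
  simp only [Pi.smul_apply, Finset.sum_apply, smul_eq_mul]
  generalize ∑ k, ‖v k‖ ^ 2 * u k 0 = X
  generalize ∑ k, ‖v k‖ ^ 2 * u k 1 = Y
  simp only [edot, perp, Matrix.cons_val_zero, Matrix.cons_val_one] at hac ⊢
  constructor
  · rintro ⟨h0, h1⟩
    rw [← h0, ← h1]
    constructor <;> ring
  · rintro ⟨h0, h1⟩
    constructor
    · apply mul_right_cancel₀ hac.ne
      linear_combination (-1 / 2 * a 0) * h1 + 1 / 2 * c 1 * h0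
    · apply mul_right_cancel₀ hac.ne
      linear_combination (-1 / 2 * a 1) * h1 - 1 / 2 * c 0 * h0
end
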